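/- Let m ≥ 1 and n be natural numbers, and let r, t : Fin m → Fin n → ℝ be such that for every j in Fin m, both r j and t j are sorted in non-ascending order (antitone). Then for every family of permutations σ_j of Fin n indexed by j in Fin m, max_{j ∈ Fin m} (∑_{i} max(r j i − t j i, 0)) ≤ max_{j ∈ Fin m} (∑_{i} max(r j i − t j (σ_j i), 0)), where the outer maximum is taken over the (nonempty) index set Fin m. (GND lower bound computation for the MAX aggregate: the maximum over matching vertex pairs of the per-vertex sorted-difference lower bounds is a lower bound of the generalized neighbor difference GND(q, g) under the MAX aggregation function, for any choice of neighbor matchings.) -/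

import Mathlib

theorem exchange_aux (a b c d : ℝ) (h1 : b ≤ a) (h2 : d ≤ c) :
    max (a - c) 0 + max (b - d) 0 ≤ max (a - d) 0 + max (b - c) 0 := by
  grind

theorem sorted_aux (n : ℕ) : ∀ (r t : Fin n → ℝ) (_ : Antitone r) (_ : Antitone t)
    (σ : Equiv.Perm (Fin n)),
    ∑ i, max (r i - t i) 0 ≤ ∑ i, max (r i - t (σ i)) 0 := by
  induction n with
  | zero => intro r t _ _ σ; simp
  | succ n ih =>
    intro r t hr ht σ
    obtain ⟨⟨p, e⟩, rfl⟩ := Equiv.Perm.decomposeFin.symm.surjective σ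
    have h := ih (fun i => r i.succ) (fun i => t i.succ)
      (fun i j hij => hr (Fin.succ_le_succ_iff.mpr hij))
      (fun i j hij => ht (Fin.succ_le_succ_iff.mpr hij)) e
    rw [Fin.sum_univ_succ, Fin.sum_univ_succ]
    simp only [Equiv.Perm.decomposeFin_symm_apply_zero, Equiv.Perm.decomposeFin_symm_apply_succ]
    refine (add_le_add_right h _).trans ?_
    induction p using Fin.cases with
    | zero => simp
    | succ k =>
      rw [← Finset.add_sum_erase _ _ (Finset.mem_univ (e.symm k)),
        ← Finset.add_sum_erase Finset.univ
          (fun i => max (r i.succ - t (Equiv.swap 0 k.succ (e i).succ)) 0)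
          (Finset.mem_univ (e.symm k)), ← add_assoc, ← add_assoc]
      apply add_le_add
      · simp only [Equiv.apply_symm_apply, Equiv.swap_apply_right]
        exact exchange_aux _ _ _ _ (hr (Fin.zero_le _)) (ht (Fin.zero_le _))
      · apply le_of_eq
        apply Finset.sum_congr rfl
        intro i hi
        have hne : e i ≠ k := by
          intro hk
          exact (Finset.ne_of_mem_erase hi) (by simp [← hk])
        rw [Equiv.swap_apply_of_ne_of_ne (Fin.succ_ne_zero _)
          (fun hk => hne (Fin.succ_injective _ hk))]


/-- GND lower bound computation for the MAX aggregate: the maximum over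
matching vertex pairs of the per-vertex sorted-difference lower bounds is a
lower bound of the generalized neighbor difference under MAX aggregation,
for any choice of neighbor matchings. -/
theorem gnd_max_lowerBound (m n : ℕ) (hm : 1 ≤ m) (r t : Fin m → Fin n → ℝ)
    (hr : ∀ j, Antitone (r j)) (ht : ∀ j, Antitone (t j))
    (σ : Fin m → Equiv.Perm (Fin n)) :
    Finset.univ.sup' (Finset.univ_nonempty_iff.mpr ⟨⟨0, hm⟩⟩)
        (fun j => ∑ i, max (r j i - t j i) 0)
      ≤ Finset.univ.sup' (Finset.univ_nonempty_iff.mpr ⟨⟨0, hm⟩⟩)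
          (fun j => ∑ i, max (r j i - t j (σ j i)) 0) := by

  apply Finset.sup'_le
  intro j hj
  exact (sorted_aux n (r j) (t j) (hr j) (ht j) (σ j)).trans
    (Finset.le_sup' (fun j => ∑ i, max (r j i - t j (σ j i)) 0) hj)
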